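/- For every positive integer n > 1 there exists a prime number p satisfying 5n < p < 6n. -/

import Mathlib

open ArithmeticFunction hiding log id
open Chebyshev Finset Real

/-- Chebyshev's constant `log (2 ^ (1 / 2) * 3 ^ (1 / 3) * 5 ^ (1 / 5) / 30 ^ (1 / 30))`. -/
noncomputable def chebyshevConst : ℝ := 7 / 15 * log 2 + 3 / 10 * log 3 + 1 / 6 * log 5

lemma chebyshevConst_gt : 0.92 < chebyshevConst := by
  have := log_two_gt_d9
  have := log_three_gt_d9
  have := log_five_gt_d9
  unfold chebyshevConst
  linarith

lemma chebyshevConst_lt : chebyshevConst < 1 := by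
  have := log_two_lt_d9
  have := log_three_lt_d9
  have := log_five_lt_d9
  unfold chebyshevConst
  linarith

lemma sub_le_mul_log_sub_log {x y : ℝ} (hx : 0 < x) (hy : 0 < y) :
    y - x ≤ y * (log y - log x) := by
  have h := log_le_sub_one_of_pos (div_pos hx hy)
  rw [log_div hx.ne' hy.ne'] at h
  have h' := mul_le_mul_of_nonneg_left h hy.le
  have : y * (x / y - 1) = x - y := by field_simp
  linarith

lemma mul_log_sub_self_le {x y : ℝ} (hx : 1 ≤ x) (hxy : x ≤ y) :
    x * log x - x ≤ y * log y - y := by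
  have h := sub_le_mul_log_sub_log (by linarith : 0 < x) (by linarith : 0 < y)
  nlinarith [mul_nonneg (sub_nonneg.2 hxy) (log_nonneg hx)]

lemma log_le_two_mul_sqrt_sub_two {x : ℝ} (hx : 0 < x) : log x ≤ 2 * √x - 2 := by
  have h := log_le_sub_one_of_pos (sqrt_pos.2 hx)
  rw [log_sqrt hx.le] at h
  linarith

lemma log_factorial_le {n : ℕ} (hn : 1 ≤ n) :
    log (n.factorial : ℝ) ≤ n * log n - n + log n + 1 := by
  induction n, hn using Nat.le_induction with
  | base => simp
  | succ n hn ih =>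
    have hn' : (0 : ℝ) < n := by exact_mod_cast hn
    have h := sub_le_mul_log_sub_log hn' (by linarith : (0 : ℝ) < n + 1)
    rw [Nat.factorial_succ]
    push_cast
    rw [log_mul (by positivity) (by positivity)]
    linarith

lemma le_log_factorial (n : ℕ) :
    (n + 1 : ℝ) * log (n + 1) - (n + 1) - log (n + 1) ≤ log (n.factorial : ℝ) := by
  have h := Stirling.le_log_factorial_stirling n.succ_ne_zero
  rw [Nat.factorial_succ] at h
  push_cast at h
  rw [log_mul (x := (n : ℝ) + 1) (by positivity) (by positivity)] at h
  have h1 : 0 ≤ log ((n : ℝ) + 1) := log_nonneg (by linarith [n.cast_nonneg (α := ℝ)])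
  have h2 : 0 ≤ log (2 * π) := log_nonneg (by linarith [pi_gt_three])
  linarith

lemma abs_log_factorial_div_sub_le {N d : ℕ} (hd : 0 < d) (hN : d ≤ N) :
    |log ((N / d).factorial : ℝ) - (N / d * (log N - log d) - N / d)| ≤ log N + 1 := by
  have hd' : (1 : ℝ) ≤ d := by exact_mod_cast hd
  have hN' : (d : ℝ) ≤ N := by exact_mod_cast hN
  have hn : 1 ≤ N / d := Nat.div_pos hN hd
  have hn' : (1 : ℝ) ≤ (N / d : ℕ) := by exact_mod_cast hn
  have hle : ((N / d : ℕ) : ℝ) ≤ N / d := Nat.cast_div_le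
  have hlt : (N / d : ℝ) < (N / d : ℕ) + 1 := by
    rw [div_lt_iff₀' (by linarith)]
    exact_mod_cast Nat.lt_mul_div_succ N hd
  have hx : (N / d : ℝ) ≤ N := div_le_self (by linarith) hd'
  rw [← log_div (by linarith) (by linarith)]
  generalize (N / d : ℝ) = x at *
  generalize N / d = n at *
  have hlog : log x ≤ log N := log_le_log (by linarith) hx
  rw [abs_le]
  constructor
  · have h1 := le_log_factorial n
    have h2 := mul_log_sub_self_le (by linarith) hlt.le
    have h3 : log ((n : ℝ) + 1) ≤ log (2 * x) := log_le_log (by linarith) (by linarith)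
    rw [log_mul (by norm_num) (by linarith)] at h3
    linarith [log_two_lt_d9]
  · have h1 := log_factorial_le hn
    have h2 := mul_log_sub_self_le hn' hle
    have h3 : log (n : ℝ) ≤ log x := log_le_log (by linarith) hle
    linarith

/-- Chebyshev's combination of logarithms of factorials. -/
noncomputable def chebyshevSum (N : ℕ) : ℝ :=
  log (N.factorial : ℝ) - log ((N / 2).factorial : ℝ) - log ((N / 3).factorial : ℝ)
    - log ((N / 5).factorial : ℝ) + log ((N / 30).factorial : ℝ)

lemma abs_chebyshevSum_sub_le {N : ℕ} (hN : 30 ≤ N) :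
    |chebyshevSum N - chebyshevConst * N| ≤ 5 * log N + 5 := by
  have h1 := abs_le.1 (abs_log_factorial_div_sub_le (N := N) (d := 1) (by norm_num) (by lia))
  have h2 := abs_le.1 (abs_log_factorial_div_sub_le (N := N) (d := 2) (by norm_num) (by lia))
  have h3 := abs_le.1 (abs_log_factorial_div_sub_le (N := N) (d := 3) (by norm_num) (by lia))
  have h5 := abs_le.1 (abs_log_factorial_div_sub_le (N := N) (d := 5) (by norm_num) (by lia))
  have h30 := abs_le.1 (abs_log_factorial_div_sub_le (N := N) (d := 30) (by norm_num) (by lia))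
  have h : log (30 : ℝ) = log 2 + log 3 + log 5 := by
    rw [← log_mul (by norm_num) (by norm_num), ← log_mul (by norm_num) (by norm_num)]
    norm_num
  simp only [Nat.cast_one, Nat.cast_ofNat, log_one, h, Nat.div_one, div_one] at h1 h2 h3 h5 h30
  unfold chebyshevSum chebyshevConst
  rw [abs_le]
  constructor <;> linarith

lemma sum_vonMangoldt_mul_div {N n : ℕ} (hn : n ≤ N) :
    ∑ d ∈ Ioc 0 N, Λ d * (n / d : ℕ) = log (n.factorial : ℝ) := by
  induction n with
  | zero => simp
  | succ n ih =>
    have hdiv : {d ∈ Ioc 0 N | d ∣ n + 1} = (n + 1).divisors := by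
      ext d
      simp only [mem_filter, mem_Ioc, Nat.mem_divisors]
      constructor
      · rintro ⟨-, h⟩
        exact ⟨h, n.succ_ne_zero⟩
      · rintro ⟨h, -⟩
        exact ⟨⟨Nat.pos_of_dvd_of_pos h n.succ_pos, (Nat.le_of_dvd n.succ_pos h).trans hn⟩, h⟩
    simp only [Nat.succ_div, Nat.cast_add, mul_add, sum_add_distrib, ih (by lia)]
    simp only [Nat.cast_ite, Nat.cast_one, Nat.cast_zero, mul_ite, mul_one, mul_zero]
    rw [← sum_filter, hdiv, vonMangoldt_sum, Nat.factorial_succ, Nat.cast_mul,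
      log_mul (by positivity) (by positivity), add_comm]

lemma log_factorial_div_eq_sum (N k : ℕ) :
    log ((N / k).factorial : ℝ) = ∑ d ∈ Ioc 0 N, Λ d * (N / d / k : ℕ) := by
  rw [← sum_vonMangoldt_mul_div (Nat.div_le_self N k)]
  simp only [Nat.div_div_eq_div_mul, mul_comm]

lemma psi_div_eq_sum (N : ℕ) {k : ℕ} (hk : 0 < k) :
    ψ (N / k : ℕ) = ∑ d ∈ Ioc 0 N, Λ d * (if k ≤ N / d then 1 else 0) := by
  simp only [mul_ite, mul_one, mul_zero]
  rw [psi, Nat.floor_natCast, ← sum_filter]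
  congr 1
  ext d
  simp only [mem_filter, mem_Ioc]
  constructor
  · rintro ⟨h0, h⟩
    refine ⟨⟨h0, h.trans (Nat.div_le_self N k)⟩, ?_⟩
    rw [Nat.le_div_iff_mul_le hk] at h
    rwa [Nat.le_div_iff_mul_le h0, mul_comm]
  · rintro ⟨⟨h0, -⟩, h⟩
    refine ⟨h0, ?_⟩
    rw [Nat.le_div_iff_mul_le h0] at h
    rwa [Nat.le_div_iff_mul_le hk, mul_comm]

lemma chebyshevSum_eq_sum (N : ℕ) :
    chebyshevSum N = ∑ d ∈ Ioc 0 N, Λ d * (((N / d : ℕ) : ℝ) - (N / d / 2 : ℕ) - (N / d / 3 : ℕ)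
      - (N / d / 5 : ℕ) + (N / d / 30 : ℕ)) := by
  have h := log_factorial_div_eq_sum N 1
  simp only [Nat.div_one] at h
  simp only [chebyshevSum, h, log_factorial_div_eq_sum N 2, log_factorial_div_eq_sum N 3,
    log_factorial_div_eq_sum N 5, log_factorial_div_eq_sum N 30, mul_add, mul_sub,
    sum_add_distrib, sum_sub_distrib]

lemma chebyshevSum_le_psi (N : ℕ) : chebyshevSum N ≤ ψ N := by
  have h := psi_div_eq_sum N one_pos
  rw [Nat.div_one] at h
  rw [chebyshevSum_eq_sum, h]
  refine sum_le_sum fun d _ ↦ mul_le_mul_of_nonneg_left ?_ vonMangoldt_nonneg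
  generalize N / d = m
  have : m + m / 30 ≤ m / 2 + m / 3 + m / 5 + if 1 ≤ m then 1 else 0 := by
    split_ifs <;> lia
  have : (m : ℝ) + (m / 30 : ℕ) ≤ (m / 2 : ℕ) + (m / 3 : ℕ) + (m / 5 : ℕ) +
      if 1 ≤ m then 1 else 0 := by exact_mod_cast this
  linarith

lemma psi_le_chebyshevSum (N : ℕ) :
    ψ N ≤ chebyshevSum N + ψ (N / 6 : ℕ) + ψ (N / 10 : ℕ) - ψ (N / 7 : ℕ) := by
  have h := psi_div_eq_sum N one_pos
  rw [Nat.div_one] at h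
  rw [chebyshevSum_eq_sum, h, psi_div_eq_sum N (by norm_num : 0 < 6),
    psi_div_eq_sum N (by norm_num : 0 < 10), psi_div_eq_sum N (by norm_num : 0 < 7),
    ← sum_add_distrib, ← sum_add_distrib, ← sum_sub_distrib]
  refine sum_le_sum fun d _ ↦ ?_
  rw [← mul_add, ← mul_add, ← mul_sub]
  refine mul_le_mul_of_nonneg_left ?_ vonMangoldt_nonneg
  generalize N / d = m
  have : (if 1 ≤ m then 1 else 0) + (if 7 ≤ m then 1 else 0) + m / 2 + m / 3 + m / 5
      ≤ m + m / 30 + (if 6 ≤ m then 1 else 0) + (if 10 ≤ m then 1 else 0) := by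
    split_ifs <;> lia
  have : (if 1 ≤ m then 1 else 0) + (if 7 ≤ m then 1 else 0) + ((m / 2 : ℕ) : ℝ) + (m / 3 : ℕ)
      + (m / 5 : ℕ) ≤ m + (m / 30 : ℕ) + (if 6 ≤ m then 1 else 0) + (if 10 ≤ m then 1 else 0) := by
    exact_mod_cast this
  linarith

lemma le_psi_natCast {N : ℕ} (hN : 30 ≤ N) :
    chebyshevConst * N - 5 * log N - 5 ≤ ψ N := by
  have := abs_le.1 (abs_chebyshevSum_sub_le hN)
  have := chebyshevSum_le_psi N
  linarith

lemma sqrt_natCast_div_le (N : ℕ) {k : ℕ} {c : ℝ} (hk : 0 < k) (hc : 0 ≤ c) (h : 1 ≤ c ^ 2 * k) :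
    √((N / k : ℕ) : ℝ) ≤ c * √N := by
  have hk' : (0 : ℝ) < k := by exact_mod_cast hk
  rw [← sqrt_sq hc, ← sqrt_mul (sq_nonneg c)]
  refine sqrt_le_sqrt (Nat.cast_div_le.trans ?_)
  rw [div_le_iff₀ hk']
  nlinarith [N.cast_nonneg (α := ℝ)]

lemma psi_le_numeral_mul_self {x : ℝ} (hx : 0 ≤ x) : ψ x ≤ 5.3863 * x := by
  refine (psi_le_const_mul_self hx).trans (mul_le_mul_of_nonneg_right ?_ hx)
  have : log (4 : ℝ) = 2 * log 2 := by
    rw [← log_rpow (by norm_num)]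
    norm_num
  linarith [log_two_lt_d9]

lemma psi_natCast_le (N : ℕ) : ψ N ≤ 90 / 77 * chebyshevConst * N + 80 * √N := by
  induction N using Nat.strong_induction_on with
  | _ N ih =>
  have hA := chebyshevConst_gt
  have hs := sq_sqrt (N.cast_nonneg (α := ℝ))
  have hs0 := sqrt_nonneg (N : ℝ)
  rcases lt_or_ge N 210 with hN | hN
  · have h := psi_le_numeral_mul_self (N.cast_nonneg (α := ℝ))
    have hN' : (N : ℝ) ≤ 210 := by exact_mod_cast hN.le
    have hs1 : √(N : ℝ) ≤ 14.5 := sqrt_le_iff.2 ⟨by norm_num, by linarith⟩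
    nlinarith
  · have hN' : (210 : ℝ) ≤ N := by exact_mod_cast hN
    have h := psi_le_chebyshevSum N
    have hE := abs_le.1 (abs_chebyshevSum_sub_le (N := N) (by lia))
    have h6 := ih (N / 6) (by lia)
    have h10 := ih (N / 10) (by lia)
    have h7 := le_psi_natCast (N := N / 7) (by lia)
    have hs6 := sqrt_natCast_div_le N (k := 6) (c := 0.40834) (by norm_num) (by norm_num)
      (by norm_num)
    have hs10 := sqrt_natCast_div_le N (k := 10) (c := 0.31624) (by norm_num) (by norm_num)
      (by norm_num)
    have hd6 : ((N / 6 : ℕ) : ℝ) ≤ N / 6 := Nat.cast_div_le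
    have hd10 : ((N / 10 : ℕ) : ℝ) ≤ N / 10 := Nat.cast_div_le
    have hd7 : (N : ℝ) / 7 - 1 ≤ (N / 7 : ℕ) := by
      have : N ≤ 7 * (N / 7) + 7 := by lia
      have : (N : ℝ) ≤ 7 * (N / 7 : ℕ) + 7 := by exact_mod_cast this
      linarith
    have hl7 : log ((N / 7 : ℕ) : ℝ) ≤ log N :=
      log_le_log (by linarith) (by exact_mod_cast Nat.div_le_self N 7)
    have hl := log_le_two_mul_sqrt_sub_two (by linarith : (0 : ℝ) < N)
    have hA0 : 0 ≤ chebyshevConst := by linarith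
    have e6 := mul_le_mul_of_nonneg_left hd6 hA0
    have e10 := mul_le_mul_of_nonneg_left hd10 hA0
    have e7 := mul_le_mul_of_nonneg_left hd7 hA0
    have hA1 := chebyshevConst_lt
    linarith

lemma psi_sub_theta_le_sqrt {x : ℝ} (hx : 1 ≤ x) : ψ x - θ x ≤ 16.1589 * √x := by
  have h := psi_sub_theta_le_psi_add_psi_add_psi x
  have h0 : 0 ≤ x := by linarith
  have key (r : ℝ) (hr : r ≤ 1 / 2) : ψ (x ^ r) ≤ 5.3863 * √x := by
    refine (psi_le_numeral_mul_self (rpow_nonneg h0 r)).trans ?_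
    rw [sqrt_eq_rpow]
    gcongr
  have h2 := key 2⁻¹ (by norm_num)
  have h3 := key 3⁻¹ (by norm_num)
  have h5 := key 5⁻¹ (by norm_num)
  linarith

lemma exists_prime_between_of_large {n : ℕ} (hn : 3000000 ≤ n) :
    ∃ p : ℕ, p.Prime ∧ 5 * n < p ∧ p < 6 * n := by
  by_contra! hno
  have hθ : θ (6 * n : ℕ) ≤ θ (5 * n : ℕ) := by
    simp only [theta, Nat.floor_natCast]
    refine sum_le_sum_of_subset_of_nonneg (fun p hp ↦ ?_) fun p hp _ ↦
      log_nonneg (by exact_mod_cast (mem_filter.1 hp).2.one_le)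
    simp only [mem_filter, mem_Ioc] at hp ⊢
    obtain ⟨⟨h0, h6⟩, hp⟩ := hp
    refine ⟨⟨h0, ?_⟩, hp⟩
    by_contra! h5
    obtain rfl : p = 6 * n := le_antisymm h6 (hno p hp h5)
    exact Nat.not_prime_mul (by norm_num) (by lia) hp
  have hn' : (3000000 : ℝ) ≤ n := by exact_mod_cast hn
  have h1 := le_psi_natCast (N := 6 * n) (by lia)
  have h2 := psi_sub_theta_le_sqrt (x := (6 * n : ℕ)) (by push_cast; linarith)
  have h3 := theta_le_psi (5 * n : ℕ)
  have h4 := psi_natCast_le (5 * n)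
  have h5 := log_le_two_mul_sqrt_sub_two (x := (6 * n : ℕ)) (by push_cast; linarith)
  have hA := chebyshevConst_gt
  have hAn := mul_le_mul_of_nonneg_right hA.le (by linarith : (0 : ℝ) ≤ n)
  have hs6 : √((6 * n : ℕ) : ℝ) ≤ 2.4495 * √n := by
    push_cast
    rw [sqrt_mul (by norm_num)]
    gcongr
    exact sqrt_le_iff.2 (by norm_num)
  have hs5 : √((5 * n : ℕ) : ℝ) ≤ 2.2361 * √n := by
    push_cast
    rw [sqrt_mul (by norm_num)]
    gcongr
    exact sqrt_le_iff.2 (by norm_num)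
  have hs : 1732 ≤ √(n : ℝ) := le_sqrt_of_sq_le (by linarith)
  have hsq := sq_sqrt (n.cast_nonneg (α := ℝ))
  push_cast at *
  nlinarith

/-- A prime `p < 6 * b` settles all `n ≥ b` with `5 * n < p`. -/
lemma exists_prime_between_of_prime {n : ℕ} (p b : ℕ) (hp : p.Prime) (hpb : p < 6 * b)
    (h : n < b → ∃ p : ℕ, p.Prime ∧ 5 * n < p ∧ p < 6 * n) (hn : 5 * n < p) :
    ∃ p : ℕ, p.Prime ∧ 5 * n < p ∧ p < 6 * n := by
  rcases lt_or_ge n b with hb | hb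
  · exact h hb
  · exact ⟨p, hp, hn, by lia⟩

lemma exists_prime_between_of_small {n : ℕ} (hn : 1 < n) (hn' : n < 3000000) :
    ∃ p : ℕ, p.Prime ∧ 5 * n < p ∧ p < 6 * n := by
  refine exists_prime_between_of_prime 15027821 2504637 (by norm_num) (by norm_num) (fun hn' ↦ ?_) (by lia)
  refine exists_prime_between_of_prime 12523183 2087201 (by norm_num) (by norm_num) (fun hn' ↦ ?_) (by lia)
  refine exists_prime_between_of_prime 10436003 1739339 (by norm_num) (by norm_num) (fun hn' ↦ ?_) (by lia)
  refine exists_prime_between_of_prime 8696693 1449450 (by norm_num) (by norm_num) (fun hn' ↦ ?_) (by lia)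
  refine exists_prime_between_of_prime 7247249 1207875 (by norm_num) (by norm_num) (fun hn' ↦ ?_) (by lia)
  refine exists_prime_between_of_prime 6039373 1006565 (by norm_num) (by norm_num) (fun hn' ↦ ?_) (by lia)
  refine exists_prime_between_of_prime 5032823 838805 (by norm_num) (by norm_num) (fun hn' ↦ ?_) (by lia)
  refine exists_prime_between_of_prime 4194023 699016 (by norm_num) (by norm_num) (fun hn' ↦ ?_) (by lia)
  refine exists_prime_between_of_prime 3495077 582516 (by norm_num) (by norm_num) (fun hn' ↦ ?_) (by lia)
  refine exists_prime_between_of_prime 2912579 485436 (by norm_num) (by norm_num) (fun hn' ↦ ?_) (by lia)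
  refine exists_prime_between_of_prime 2427179 404530 (by norm_num) (by norm_num) (fun hn' ↦ ?_) (by lia)
  refine exists_prime_between_of_prime 2022649 337109 (by norm_num) (by norm_num) (fun hn' ↦ ?_) (by lia)
  refine exists_prime_between_of_prime 1685543 280924 (by norm_num) (by norm_num) (fun hn' ↦ ?_) (by lia)
  refine exists_prime_between_of_prime 1404617 234103 (by norm_num) (by norm_num) (fun hn' ↦ ?_) (by lia)
  refine exists_prime_between_of_prime 1170511 195086 (by norm_num) (by norm_num) (fun hn' ↦ ?_) (by lia)
  refine exists_prime_between_of_prime 975427 162572 (by norm_num) (by norm_num) (fun hn' ↦ ?_) (by lia)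
  refine exists_prime_between_of_prime 812857 135478 (by norm_num) (by norm_num) (fun hn' ↦ ?_) (by lia)
  refine exists_prime_between_of_prime 677387 112900 (by norm_num) (by norm_num) (fun hn' ↦ ?_) (by lia)
  refine exists_prime_between_of_prime 564497 94086 (by norm_num) (by norm_num) (fun hn' ↦ ?_) (by lia)
  refine exists_prime_between_of_prime 470429 78407 (by norm_num) (by norm_num) (fun hn' ↦ ?_) (by lia)
  refine exists_prime_between_of_prime 392033 65339 (by norm_num) (by norm_num) (fun hn' ↦ ?_) (by lia)
  refine exists_prime_between_of_prime 326693 54450 (by norm_num) (by norm_num) (fun hn' ↦ ?_) (by lia)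
  refine exists_prime_between_of_prime 272249 45375 (by norm_num) (by norm_num) (fun hn' ↦ ?_) (by lia)
  refine exists_prime_between_of_prime 226871 37814 (by norm_num) (by norm_num) (fun hn' ↦ ?_) (by lia)
  refine exists_prime_between_of_prime 189067 31516 (by norm_num) (by norm_num) (fun hn' ↦ ?_) (by lia)
  refine exists_prime_between_of_prime 157579 26265 (by norm_num) (by norm_num) (fun hn' ↦ ?_) (by lia)
  refine exists_prime_between_of_prime 131321 21887 (by norm_num) (by norm_num) (fun hn' ↦ ?_) (by lia)
  refine exists_prime_between_of_prime 109433 18240 (by norm_num) (by norm_num) (fun hn' ↦ ?_) (by lia)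
  refine exists_prime_between_of_prime 91199 15201 (by norm_num) (by norm_num) (fun hn' ↦ ?_) (by lia)
  refine exists_prime_between_of_prime 76003 12668 (by norm_num) (by norm_num) (fun hn' ↦ ?_) (by lia)
  refine exists_prime_between_of_prime 63337 10557 (by norm_num) (by norm_num) (fun hn' ↦ ?_) (by lia)
  refine exists_prime_between_of_prime 52783 8800 (by norm_num) (by norm_num) (fun hn' ↦ ?_) (by lia)
  refine exists_prime_between_of_prime 43997 7335 (by norm_num) (by norm_num) (fun hn' ↦ ?_) (by lia)
  refine exists_prime_between_of_prime 36671 6112 (by norm_num) (by norm_num) (fun hn' ↦ ?_) (by lia)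
  refine exists_prime_between_of_prime 30559 5095 (by norm_num) (by norm_num) (fun hn' ↦ ?_) (by lia)
  refine exists_prime_between_of_prime 25471 4250 (by norm_num) (by norm_num) (fun hn' ↦ ?_) (by lia)
  refine exists_prime_between_of_prime 21247 3542 (by norm_num) (by norm_num) (fun hn' ↦ ?_) (by lia)
  refine exists_prime_between_of_prime 17707 2952 (by norm_num) (by norm_num) (fun hn' ↦ ?_) (by lia)
  refine exists_prime_between_of_prime 14759 2461 (by norm_num) (by norm_num) (fun hn' ↦ ?_) (by lia)
  refine exists_prime_between_of_prime 12301 2051 (by norm_num) (by norm_num) (fun hn' ↦ ?_) (by lia)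
  refine exists_prime_between_of_prime 10253 1709 (by norm_num) (by norm_num) (fun hn' ↦ ?_) (by lia)
  refine exists_prime_between_of_prime 8543 1426 (by norm_num) (by norm_num) (fun hn' ↦ ?_) (by lia)
  refine exists_prime_between_of_prime 7129 1191 (by norm_num) (by norm_num) (fun hn' ↦ ?_) (by lia)
  refine exists_prime_between_of_prime 5953 994 (by norm_num) (by norm_num) (fun hn' ↦ ?_) (by lia)
  refine exists_prime_between_of_prime 4967 828 (by norm_num) (by norm_num) (fun hn' ↦ ?_) (by lia)
  refine exists_prime_between_of_prime 4139 690 (by norm_num) (by norm_num) (fun hn' ↦ ?_) (by lia)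
  refine exists_prime_between_of_prime 3449 576 (by norm_num) (by norm_num) (fun hn' ↦ ?_) (by lia)
  refine exists_prime_between_of_prime 2879 480 (by norm_num) (by norm_num) (fun hn' ↦ ?_) (by lia)
  refine exists_prime_between_of_prime 2399 401 (by norm_num) (by norm_num) (fun hn' ↦ ?_) (by lia)
  refine exists_prime_between_of_prime 2003 334 (by norm_num) (by norm_num) (fun hn' ↦ ?_) (by lia)
  refine exists_prime_between_of_prime 1669 282 (by norm_num) (by norm_num) (fun hn' ↦ ?_) (by lia)
  refine exists_prime_between_of_prime 1409 237 (by norm_num) (by norm_num) (fun hn' ↦ ?_) (by lia)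
  refine exists_prime_between_of_prime 1181 197 (by norm_num) (by norm_num) (fun hn' ↦ ?_) (by lia)
  refine exists_prime_between_of_prime 983 165 (by norm_num) (by norm_num) (fun hn' ↦ ?_) (by lia)
  refine exists_prime_between_of_prime 821 137 (by norm_num) (by norm_num) (fun hn' ↦ ?_) (by lia)
  refine exists_prime_between_of_prime 683 115 (by norm_num) (by norm_num) (fun hn' ↦ ?_) (by lia)
  refine exists_prime_between_of_prime 571 96 (by norm_num) (by norm_num) (fun hn' ↦ ?_) (by lia)
  refine exists_prime_between_of_prime 479 81 (by norm_num) (by norm_num) (fun hn' ↦ ?_) (by lia)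
  refine exists_prime_between_of_prime 401 68 (by norm_num) (by norm_num) (fun hn' ↦ ?_) (by lia)
  refine exists_prime_between_of_prime 337 57 (by norm_num) (by norm_num) (fun hn' ↦ ?_) (by lia)
  refine exists_prime_between_of_prime 281 47 (by norm_num) (by norm_num) (fun hn' ↦ ?_) (by lia)
  refine exists_prime_between_of_prime 233 39 (by norm_num) (by norm_num) (fun hn' ↦ ?_) (by lia)
  refine exists_prime_between_of_prime 191 32 (by norm_num) (by norm_num) (fun hn' ↦ ?_) (by lia)
  refine exists_prime_between_of_prime 157 27 (by norm_num) (by norm_num) (fun hn' ↦ ?_) (by lia)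
  refine exists_prime_between_of_prime 131 22 (by norm_num) (by norm_num) (fun hn' ↦ ?_) (by lia)
  refine exists_prime_between_of_prime 107 18 (by norm_num) (by norm_num) (fun hn' ↦ ?_) (by lia)
  refine exists_prime_between_of_prime 89 15 (by norm_num) (by norm_num) (fun hn' ↦ ?_) (by lia)
  refine exists_prime_between_of_prime 73 13 (by norm_num) (by norm_num) (fun hn' ↦ ?_) (by lia)
  refine exists_prime_between_of_prime 61 11 (by norm_num) (by norm_num) (fun hn' ↦ ?_) (by lia)
  refine exists_prime_between_of_prime 53 9 (by norm_num) (by norm_num) (fun hn' ↦ ?_) (by lia)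
  refine exists_prime_between_of_prime 41 7 (by norm_num) (by norm_num) (fun hn' ↦ ?_) (by lia)
  refine exists_prime_between_of_prime 31 6 (by norm_num) (by norm_num) (fun hn' ↦ ?_) (by lia)
  refine exists_prime_between_of_prime 29 5 (by norm_num) (by norm_num) (fun hn' ↦ ?_) (by lia)
  refine exists_prime_between_of_prime 23 4 (by norm_num) (by norm_num) (fun hn' ↦ ?_) (by lia)
  refine exists_prime_between_of_prime 17 3 (by norm_num) (by norm_num) (fun hn' ↦ ?_) (by lia)
  refine exists_prime_between_of_prime 11 2 (by norm_num) (by norm_num) (fun hn' ↦ ?_) (by lia)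
  lia

theorem stmt_4 (n : ℕ) (hn : 1 < n) : ∃ p : ℕ, p.Prime ∧ 5 * n < p ∧ p < 6 * n := by
  rcases lt_or_ge n 3000000 with h | h
  · exact exists_prime_between_of_small hn h
  · exact exists_prime_between_of_large h
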